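/- Let m ≥ 1 and let (Ω, 𝔽, P) be a probability space carrying real random variables F and C_1, …, C_m such that F has law N(μ_f, σ_f²) and, for each j, C_j has law N(μ_{c_j}, σ_{c_j}²), with σ_f > 0 and all σ_{c_j} > 0 (no independence among F, C_1, …, C_m is assumed). Let f⁺ ∈ ℝ, α ≥ 0 and v_1, …, v_m ≥ 0 be constants. Then E[max(f⁺ − F, 0) + α·Σ_{j=1}^m v_j − α·Σ_{j=1}^m max(−C_j, 0)] = (f⁺ − μ_f)·Φ(Z_f) + σ_f·φ(Z_f) + α·Σ_{j=1}^m v_j + α·Σ_{j=1}^m (μ_{c_j}·Φ(Z_{c_j}) − σ_{c_j}·φ(Z_{c_j})), where Z_f = (f⁺ − μ_f)/σ_f and Z_{c_j} = −μ_{c_j}/σ_{c_j}. (Closed form of the form 1 expected merit improvement with m constraints.) -/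

import Mathlib

open MeasureTheory ProbabilityTheory Real

/-- The density of the standard normal distribution on `ℝ`. -/
noncomputable def stdNormalPDF (z : ℝ) : ℝ :=
  (Real.sqrt (2 * Real.pi))⁻¹ * Real.exp (-z ^ 2 / 2)

/-- The cumulative distribution function of the standard normal distribution. -/
noncomputable def stdNormalCDF (t : ℝ) : ℝ :=
  ∫ z in Set.Iic t, stdNormalPDF z

theorem gaussianPDFReal_zero_one_eq_stdNormalPDF : gaussianPDFReal 0 1 = stdNormalPDF := by
  ext z
  simp [gaussianPDFReal, stdNormalPDF]

theorem integrable_stdNormalPDF : Integrable stdNormalPDF :=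
  gaussianPDFReal_zero_one_eq_stdNormalPDF ▸ integrable_gaussianPDFReal 0 1

theorem integrable_mul_stdNormalPDF : Integrable fun z ↦ z * stdNormalPDF z := by
  refine ((integrable_mul_exp_neg_mul_sq (b := 1 / 2) (by norm_num)).const_mul
    (√(2 * π))⁻¹).congr (ae_of_all _ fun z ↦ ?_)
  simp only [stdNormalPDF]
  ring_nf

theorem hasDerivAt_stdNormalPDF (z : ℝ) :
    HasDerivAt stdNormalPDF (-(z * stdNormalPDF z)) z := by
  have h : HasDerivAt (fun x : ℝ ↦ -x ^ 2 / 2) (-z) z := by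
    refine (((hasDerivAt_id z).pow 2).neg.div_const 2).congr_deriv ?_
    simp [neg_div]
  refine (h.exp.const_mul (√(2 * π))⁻¹).congr_deriv ?_
  simp only [stdNormalPDF]
  ring

theorem integral_Iic_mul_stdNormalPDF (t : ℝ) :
    ∫ z in Set.Iic t, z * stdNormalPDF z = -stdNormalPDF t := by
  have hderiv : ∀ z ∈ Set.Iic t, HasDerivAt stdNormalPDF (-(z * stdNormalPDF z)) z :=
    fun z _ ↦ hasDerivAt_stdNormalPDF z
  have hlim := tendsto_zero_of_hasDerivAt_of_integrableOn_Iic hderiv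
    integrable_mul_stdNormalPDF.neg.integrableOn integrable_stdNormalPDF.integrableOn
  have h := integral_Iic_of_hasDerivAt_of_tendsto' hderiv
    integrable_mul_stdNormalPDF.neg.integrableOn hlim
  rw [integral_neg] at h
  linarith

/-- The expected shortfall of a standard normal variable below the threshold `t`. -/
theorem integral_max_sub_zero_gaussianReal_zero_one (t : ℝ) :
    ∫ z, max (t - z) 0 ∂gaussianReal 0 1 = t * stdNormalCDF t + stdNormalPDF t := by
  have hind (z : ℝ) : stdNormalPDF z • max (t - z) 0 =
      (Set.Iic t).indicator (fun z ↦ t * stdNormalPDF z - z * stdNormalPDF z) z := by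
    by_cases hz : z ≤ t
    · rw [Set.indicator_of_mem (Set.mem_Iic.2 hz), max_eq_left (sub_nonneg.2 hz), smul_eq_mul]
      ring
    · rw [Set.indicator_of_notMem (by simpa using hz),
        max_eq_right (sub_nonpos.2 (not_le.1 hz).le), smul_zero]
  rw [integral_gaussianReal_eq_integral_smul one_ne_zero,
    gaussianPDFReal_zero_one_eq_stdNormalPDF]
  simp_rw [hind]
  rw [integral_indicator measurableSet_Iic,
    integral_sub (integrable_stdNormalPDF.const_mul t).integrableOn
      integrable_mul_stdNormalPDF.integrableOn,
    integral_const_mul, integral_Iic_mul_stdNormalPDF, stdNormalCDF, sub_neg_eq_add]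

/-- The expected shortfall of a normal variable below the threshold `a`. -/
theorem integral_max_sub_zero_gaussianReal (a μ : ℝ) {σ : ℝ} (hσ : 0 < σ) :
    ∫ x, max (a - x) 0 ∂gaussianReal μ ⟨σ ^ 2, sq_nonneg σ⟩ =
      (a - μ) * stdNormalCDF ((a - μ) / σ) + σ * stdNormalPDF ((a - μ) / σ) := by
  have hmap : gaussianReal μ ⟨σ ^ 2, sq_nonneg σ⟩ =
      (gaussianReal 0 1).map fun z ↦ μ + σ * z := by
    have hcomp : (fun z ↦ μ + σ * z) = (fun x ↦ μ + x) ∘ fun z ↦ σ * z := rfl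
    rw [hcomp, ← Measure.map_map (by fun_prop) (by fun_prop), gaussianReal_map_const_mul,
      gaussianReal_map_const_add, mul_zero, zero_add, mul_one]
    rfl
  have hscale (z : ℝ) : max (a - (μ + σ * z)) 0 = σ * max ((a - μ) / σ - z) 0 := by
    rw [mul_max_of_nonneg _ _ hσ.le, mul_zero, mul_sub, mul_div_cancel₀ _ hσ.ne', sub_sub]
  rw [hmap, integral_map (by fun_prop) (by fun_prop)]
  simp_rw [hscale]
  rw [integral_const_mul, integral_max_sub_zero_gaussianReal_zero_one, mul_add, ← mul_assoc,
    mul_div_cancel₀ _ hσ.ne']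

theorem integrable_max_sub_zero_of_map_eq_gaussianReal {Ω : Type*} [MeasurableSpace Ω]
    {P : Measure Ω} {X : Ω → ℝ} (hX : Measurable X) {μ : ℝ} {v : NNReal}
    (hlaw : P.map X = gaussianReal μ v) (a : ℝ) :
    Integrable (fun ω ↦ max (a - X ω) 0) P := by
  have hid : Integrable (fun x : ℝ ↦ max (a - x) 0) (P.map X) := by
    rw [hlaw]
    exact ((integrable_const a).sub
      ((memLp_id_gaussianReal 1).integrable (by simp))).pos_part
  exact hid.comp_measurable hX

theorem integral_max_sub_zero_of_map_eq_gaussianReal {Ω : Type*} [MeasurableSpace Ω]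
    {P : Measure Ω} {X : Ω → ℝ} (hX : Measurable X) {μ σ : ℝ} (hσ : 0 < σ)
    (hlaw : P.map X = gaussianReal μ ⟨σ ^ 2, sq_nonneg σ⟩) (a : ℝ) :
    ∫ ω, max (a - X ω) 0 ∂P =
      (a - μ) * stdNormalCDF ((a - μ) / σ) + σ * stdNormalPDF ((a - μ) / σ) := by
  rw [← integral_max_sub_zero_gaussianReal a μ hσ, ← hlaw,
    integral_map hX.aemeasurable (by fun_prop)]

/-- Closed form of the form 1 expected merit improvement with `m` constraints. -/
theorem form1_expected_merit_improvement_multi_closed_form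
    {Ω : Type*} [MeasurableSpace Ω] (P : Measure Ω) [IsProbabilityMeasure P]
    (m : ℕ) (hm : 1 ≤ m)
    (F : Ω → ℝ) (C : Fin m → Ω → ℝ)
    (hF : Measurable F) (hC : ∀ j, Measurable (C j))
    (μf σf : ℝ) (μc σc : Fin m → ℝ) (hσf : 0 < σf) (hσc : ∀ j, 0 < σc j)
    (hlawF : P.map F = gaussianReal μf (⟨σf ^ 2, sq_nonneg σf⟩ : NNReal))
    (hlawC : ∀ j, P.map (C j) = gaussianReal (μc j) (⟨σc j ^ 2, sq_nonneg (σc j)⟩ : NNReal))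
    (fplus α : ℝ) (v : Fin m → ℝ) (hα : 0 ≤ α) (hv : ∀ j, 0 ≤ v j) :
    ∫ ω, (max (fplus - F ω) 0 + α * ∑ j, v j - α * ∑ j, max (-C j ω) 0) ∂P =
      (fplus - μf) * stdNormalCDF ((fplus - μf) / σf)
        + σf * stdNormalPDF ((fplus - μf) / σf)
        + α * ∑ j, v j
        + α * ∑ j, (μc j * stdNormalCDF (-μc j / σc j)
            - σc j * stdNormalPDF (-μc j / σc j)) := by
  have hFint := integrable_max_sub_zero_of_map_eq_gaussianReal hF hlawF fplus
  have hCint (j : Fin m) : Integrable (fun ω ↦ max (-C j ω) 0) P := by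
    simpa using integrable_max_sub_zero_of_map_eq_gaussianReal (hC j) (hlawC j) 0
  have hCval (j : Fin m) : ∫ ω, max (-C j ω) 0 ∂P =
      -(μc j * stdNormalCDF (-μc j / σc j) - σc j * stdNormalPDF (-μc j / σc j)) := by
    have h := integral_max_sub_zero_of_map_eq_gaussianReal (hC j) (hσc j) (hlawC j) 0
    simp only [zero_sub] at h
    rw [h]
    ring
  rw [integral_sub (by fun_prop)
      ((integrable_finsetSum Finset.univ fun j _ ↦ hCint j).const_mul α),
    integral_add hFint (integrable_const _), integral_const, integral_const_mul,
    integral_finsetSum _ fun j _ ↦ hCint j,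
    integral_max_sub_zero_of_map_eq_gaussianReal hF hσf hlawF]
  simp only [hCval, Finset.sum_neg_distrib, probReal_univ, one_smul]
  ring
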